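/- There exists an absolute constant c > 0 with the following property. Let X be a set, μ a distribution on X, f* : X → [0,1], and let (x_i, y_i), i = 1,…,n, be i.i.d. with x_i ~ μ, y_i ∈ [0,1], and E[y_i | x_i] = f*(x_i). Let F be a finite class of functions from X to [0,1] with f* ∈ F. Then for any δ ∈ (0,1], with probability at least 1 − δ: Σ_{i=1}^n (f*(x_i) − y_i)² − min_{f ∈ F} Σ_{i=1}^n (f(x_i) − y_i)² ≤ c · log(|F|/δ). -/

import Mathlib

open MeasureTheory Finset

namespace SquareLossRegression

/-- On a product with a standard Borel fibre, a cylinder over an arbitrary set has the same outer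
measure as its base. -/
theorem measure_fst_preimage {X Ω : Type*} [MeasurableSpace X] [MeasurableSpace Ω]
    [StandardBorelSpace Ω] [Nonempty Ω] (ν : Measure (X × Ω)) [IsFiniteMeasure ν] (A : Set X) :
    ν (Prod.fst ⁻¹' A) = ν.fst A := by
  apply le_antisymm
  · calc ν (Prod.fst ⁻¹' A) ≤ ν (Prod.fst ⁻¹' toMeasurable ν.fst A) :=
          measure_mono (Set.preimage_mono (subset_toMeasurable _ _))
      _ = ν.fst (toMeasurable ν.fst A) :=
          (Measure.fst_apply (measurableSet_toMeasurable _ _)).symm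
      _ = ν.fst A := measure_toMeasurable _
  · set T := toMeasurable ν (Prod.fst ⁻¹' A)
    have hTm : MeasurableSet T := measurableSet_toMeasurable _ _
    have hmeas : Measurable fun x => ν.condKernel x (Prod.mk x ⁻¹' T) :=
      ProbabilityTheory.Kernel.measurable_kernel_prodMk_left hTm
    calc ν.fst A ≤ ν.fst {x | 1 ≤ ν.condKernel x (Prod.mk x ⁻¹' T)} := by
          refine measure_mono fun x hx => ?_
          have : Prod.mk x ⁻¹' T = Set.univ :=
            Set.eq_univ_of_forall fun y => subset_toMeasurable ν _ (show x ∈ A from hx)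
          simp [this]
      _ ≤ ∫⁻ x, ν.condKernel x (Prod.mk x ⁻¹' T) ∂ν.fst := by
          simpa using mul_meas_ge_le_lintegral hmeas 1
      _ = (ν.fst.compProd ν.condKernel) T := (Measure.compProd_apply hTm).symm
      _ = ν T := by rw [ν.disintegrate ν.condKernel]
      _ = ν (Prod.fst ⁻¹' A) := measure_toMeasurable _

/-- An arbitrary labelling `G` of the base space can be replaced by a measurable labelling `G'`
such that every measurable event on i.i.d. samples that forces a measurable relation between the
sample and its `G`-labels almost surely forces that relation for its `G'`-labels. -/
theorem exists_measurable_labelling {X Ω : Type*} [MeasurableSpace X] [MeasurableSpace Ω]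
    [StandardBorelSpace Ω] [Nonempty Ω] (ν : Measure (X × Ω)) [IsFiniteMeasure ν] (G : X → ℕ) :
    ∃ G' : X → ℕ, Measurable G' ∧ ∀ (n : ℕ) (P : (Fin n → ℕ) → Set (Fin n → X × Ω))
      (S : Set (Fin n → X × Ω)), (∀ k, MeasurableSet (P k)) → MeasurableSet S →
      (∀ᵐ ω ∂Measure.pi fun _ : Fin n => ν, ω ∈ S → ω ∈ P fun j => G (ω j).1) →
      ∀ᵐ ω ∂Measure.pi fun _ : Fin n => ν, ω ∈ S → ω ∈ P fun j => G' (ω j).1 := by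
  classical
  set H : ℕ → Set X := fun k => toMeasurable ν.fst (G ⁻¹' {k}) with hH
  have hGH : ∀ k, G ⁻¹' {k} ⊆ H k := fun k => subset_toMeasurable _ _
  have hex : ∀ x, ∃ k, x ∈ H k := fun x => ⟨G x, hGH _ rfl⟩
  refine ⟨fun x => Nat.find (hex x),
    measurable_find hex fun k => measurableSet_toMeasurable _ _, ?_⟩
  intro n P S hP hS hSP
  have key : ∀ k : Fin n → ℕ, (Measure.pi fun _ : Fin n => ν)
      ((Set.univ.pi fun j => Prod.fst ⁻¹' H (k j)) ∩ (S \ P k)) = 0 := by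
    intro k
    rw [← Measure.measure_inter_eq_of_measure_eq (hS.diff (hP k))
      (t := Set.univ.pi fun j => Prod.fst ⁻¹' (G ⁻¹' {k j}))]
    · refine measure_mono_null ?_ (ae_iff.1 hSP)
      rintro ω ⟨hω, hωS, hωP⟩
      have : (fun j => G (ω j).1) = k := funext fun j => hω j trivial
      simpa [this] using ⟨hωS, hωP⟩
    · simp only [Measure.pi_pi, measure_fst_preimage, hH, measure_toMeasurable]
    · exact Set.pi_mono fun j _ => Set.preimage_mono (hGH _)
    · exact measure_ne_top _ _
  rw [ae_iff]
  refine measure_mono_null ?_ (measure_iUnion_null key)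
  intro ω hω
  simp only [Set.mem_ofPred_eq, Classical.not_imp] at hω
  exact Set.mem_iUnion.2 ⟨fun j => Nat.find (hex (ω j).1),
    fun j _ => Nat.find_spec (hex (ω j).1), hω⟩

theorem exp_quarter_sq_sub_sq_le {h f y : ℝ} (hh : h ∈ Set.Icc (0 : ℝ) 1)
    (hf : f ∈ Set.Icc (0 : ℝ) 1) (hy : y ∈ Set.Icc (0 : ℝ) 1) :
    Real.exp (1 / 4 * ((h - y) ^ 2 - (f - y) ^ 2)) ≤ 1 + 1 / 2 * ((f - h) * (y - h)) := by
  obtain ⟨hh0, hh1⟩ := hh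
  obtain ⟨hf0, hf1⟩ := hf
  obtain ⟨hy0, hy1⟩ := hy
  have h1 : (h - y) ^ 2 ≤ 1 := by nlinarith
  have h2 : (f - y) ^ 2 ≤ 1 := by nlinarith
  have habs : |1 / 4 * ((h - y) ^ 2 - (f - y) ^ 2)| ≤ 1 :=
    abs_le.2 ⟨by nlinarith [sq_nonneg (h - y)], by nlinarith [sq_nonneg (f - y)]⟩
  have hexp := (abs_le.1 (Real.abs_exp_sub_one_sub_id_le habs)).2
  have hs : (h + f - 2 * y) ^ 2 ≤ 4 := by nlinarith
  have := mul_le_mul_of_nonneg_left hs (sq_nonneg (f - h))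
  nlinarith

/-- The square-loss advantage of the regression function has exponential moment at most one. -/
theorem integral_exp_quarter_sq_sub_sq_le_one {X : Type*} [MeasurableSpace X]
    {ν : Measure (X × ℝ)} [IsProbabilityMeasure ν] {h f : X → ℝ} (hh : Measurable h)
    (hf : Measurable f) (hh01 : ∀ x, h x ∈ Set.Icc (0 : ℝ) 1)
    (hf01 : ∀ x, f x ∈ Set.Icc (0 : ℝ) 1) (hy : ∀ᵐ p ∂ν, p.2 ∈ Set.Icc (0 : ℝ) 1)
    (horth : ∫ p, (f p.1 - h p.1) * (p.2 - h p.1) ∂ν = 0) :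
    Integrable (fun p => Real.exp (1 / 4 * ((h p.1 - p.2) ^ 2 - (f p.1 - p.2) ^ 2))) ν ∧
    ∫ p, Real.exp (1 / 4 * ((h p.1 - p.2) ^ 2 - (f p.1 - p.2) ^ 2)) ∂ν ≤ 1 := by
  have hle : ∀ᵐ p ∂ν, Real.exp (1 / 4 * ((h p.1 - p.2) ^ 2 - (f p.1 - p.2) ^ 2)) ≤
      1 + 1 / 2 * ((f p.1 - h p.1) * (p.2 - h p.1)) := by
    filter_upwards [hy] with p hp using exp_quarter_sq_sub_sq_le (hh01 _) (hf01 _) hp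
  have hint : Integrable (fun p : X × ℝ => (f p.1 - h p.1) * (p.2 - h p.1)) ν := by
    refine Integrable.of_bound (by fun_prop) 1 ?_
    filter_upwards [hy] with p hp
    have h1 := hh01 p.1
    have h2 := hf01 p.1
    simp only [Set.mem_Icc] at h1 h2 hp
    rw [Real.norm_eq_abs, abs_mul]
    exact mul_le_one₀ (abs_le.2 ⟨by linarith, by linarith⟩) (abs_nonneg _)
      (abs_le.2 ⟨by linarith, by linarith⟩)
  have hint' := (integrable_const (μ := ν) (1 : ℝ)).add (hint.const_mul (1 / 2))
  have hintexp : Integrable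
      (fun p => Real.exp (1 / 4 * ((h p.1 - p.2) ^ 2 - (f p.1 - p.2) ^ 2))) ν := by
    refine hint'.mono' (by fun_prop) ?_
    filter_upwards [hle] with p hp
    simpa [abs_of_pos (Real.exp_pos _)] using hp
  refine ⟨hintexp, (integral_mono_ae hintexp hint' hle).trans ?_⟩
  have := integral_add (integrable_const (μ := ν) (1 : ℝ)) (hint.const_mul (1 / 2))
  simp only [Pi.add_apply] at this ⊢
  rw [this, integral_const_mul, horth]
  simp

/-- Chernoff bound for i.i.d. sums with exponential moment at most one. -/
theorem measureReal_pi_ge_le_exp {Ω : Type*} [MeasurableSpace Ω] {ν : Measure Ω}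
    [IsProbabilityMeasure ν] {Z : Ω → ℝ} {r : ℝ} (hr : 0 ≤ r)
    (hint : Integrable (fun p => Real.exp (r * Z p)) ν) (hle : ∫ p, Real.exp (r * Z p) ∂ν ≤ 1)
    (n : ℕ) (t : ℝ) :
    (Measure.pi fun _ : Fin n => ν).real {ω | t ≤ ∑ j, Z (ω j)} ≤ Real.exp (-r * t) := by
  have hprod : (fun ω : Fin n → Ω => Real.exp (r * ∑ j, Z (ω j))) =
      fun ω => ∏ j, Real.exp (r * Z (ω j)) := by
    funext ω
    rw [mul_sum, Real.exp_sum]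
  refine (ProbabilityTheory.measure_ge_le_exp_mul_mgf t hr ?_).trans ?_
  · rw [hprod]
    exact Integrable.fintype_prod fun _ => hint
  · refine mul_le_of_le_one_right (Real.exp_pos _).le ?_
    rw [ProbabilityTheory.mgf, hprod,
      integral_fintype_prod_eq_pow (ι := Fin n) (fun p => Real.exp (r * Z p))]
    exact pow_le_one₀ (integral_nonneg fun _ => (Real.exp_pos _).le) hle

/-- The conditional mean of a `[0,1]`-valued response has a measurable `[0,1]`-valued version,
whose residual is orthogonal to bounded measurable functions of the covariate. -/
theorem exists_measurable_regression_function {X : Type*} [mX : MeasurableSpace X]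
    {ν : Measure (X × ℝ)} [IsProbabilityMeasure ν] {fstar : X → ℝ}
    (hfstar : ∀ x, fstar x ∈ Set.Icc (0 : ℝ) 1) (hy : ∀ᵐ p ∂ν, p.2 ∈ Set.Icc (0 : ℝ) 1)
    (hcond : ν[(fun p : X × ℝ => p.2) | MeasurableSpace.comap Prod.fst mX]
      =ᵐ[ν] fun p : X × ℝ => fstar p.1) :
    ∃ h : X → ℝ, Measurable h ∧ (∀ x, h x ∈ Set.Icc (0 : ℝ) 1) ∧
      (∀ᵐ p ∂ν, fstar p.1 = h p.1) ∧
      ∀ d : X → ℝ, Measurable d → (∀ x, |d x| ≤ 1) →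
        ∫ p, d p.1 * (p.2 - h p.1) ∂ν = 0 := by
  have hm : MeasurableSpace.comap Prod.fst mX ≤ (inferInstance : MeasurableSpace (X × ℝ)) :=
    measurable_fst.comap_le
  obtain ⟨g, hg, hgeq⟩ := (stronglyMeasurable_condExp (μ := ν)
    (m := MeasurableSpace.comap Prod.fst mX)
    (f := fun p : X × ℝ => p.2)).measurable.exists_eq_measurable_comp
  have hinty : Integrable (fun p : X × ℝ => p.2) ν := by
    refine Integrable.of_bound (by fun_prop) 1 ?_
    filter_upwards [hy] with p hp
    rw [Real.norm_eq_abs]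
    exact abs_le.2 ⟨by linarith [hp.1], hp.2⟩
  have hae : ∀ᵐ p ∂ν, fstar p.1 = max 0 (min 1 (g p.1)) := by
    filter_upwards [hcond] with p hp
    rw [hgeq] at hp
    simp only [Function.comp_apply] at hp
    rw [hp, min_eq_right (hfstar _).2, max_eq_right (hfstar _).1]
  have hhm : Measurable fun x => max 0 (min 1 (g x)) := by fun_prop
  refine ⟨fun x => max 0 (min 1 (g x)), hhm, fun x =>
    ⟨le_max_left _ _, max_le zero_le_one (min_le_left _ _)⟩, hae, fun d hd hd1 => ?_⟩
  have hbd : ∀ᵐ p ∂ν, ‖d p.1‖ ≤ 1 := ae_of_all _ fun p => hd1 _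
  have hdm : StronglyMeasurable[MeasurableSpace.comap Prod.fst mX] fun p : X × ℝ => d p.1 :=
    (hd.comp (comap_measurable (Prod.fst : X × ℝ → X))).stronglyMeasurable
  have hpull := condExp_stronglyMeasurable_mul_of_bound hm hdm hinty 1 hbd
  have hI1 : Integrable (fun p : X × ℝ => d p.1 * p.2) ν :=
    hinty.bdd_mul (hd.comp measurable_fst).aestronglyMeasurable hbd
  have hI2 : Integrable (fun p : X × ℝ => d p.1 * max 0 (min 1 (g p.1))) ν := by
    refine Integrable.bdd_mul (c := 1) ?_ (hd.comp measurable_fst).aestronglyMeasurable hbd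
    refine Integrable.of_bound (hhm.comp measurable_fst).aestronglyMeasurable 1 (ae_of_all _ fun p => ?_)
    rw [Real.norm_eq_abs, abs_of_nonneg (le_max_left _ _)]
    exact max_le zero_le_one (min_le_left _ _)
  simp only [mul_sub]
  rw [integral_sub hI1 hI2, sub_eq_zero]
  calc ∫ p, d p.1 * p.2 ∂ν
      = ∫ p, (ν[(fun p : X × ℝ => d p.1) * (fun p : X × ℝ => p.2) |
          MeasurableSpace.comap Prod.fst mX]) p ∂ν := (integral_condExp hm).symm
    _ = ∫ p, d p.1 * max 0 (min 1 (g p.1)) ∂ν := by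
        refine integral_congr_ae ?_
        filter_upwards [hpull, hcond, hae] with p h1 h2 h3
        rw [h1, Pi.mul_apply, h2, h3]

/-- A finite family of `[0,1]`-valued functions is uniformly approximated by functions of a single
natural-number-valued label. -/
theorem exists_label_approx {X ι : Type*} [Fintype ι] {F : ι → X → ℝ}
    (hF : ∀ i x, F i x ∈ Set.Icc (0 : ℝ) 1) {ε : ℝ} (hε : 0 < ε) :
    ∃ (G : X → ℕ) (Φ : ℕ → ι → ℝ), (∀ k i, Φ k i ∈ Set.Icc (0 : ℝ) 1) ∧
      ∀ x i, |F i x - Φ (G x) i| ≤ ε := by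
  have hd := TopologicalSpace.denseRange_denseSeq (ι → Set.Icc (0 : ℝ) 1)
  choose G hG using fun x => hd.exists_dist_lt (fun i => ⟨F i x, hF i x⟩) hε
  refine ⟨G, fun k i => TopologicalSpace.denseSeq (ι → Set.Icc (0 : ℝ) 1) k i,
    fun k i => Subtype.prop _, fun x i => ?_⟩
  exact ((dist_pi_lt_iff hε).1 (hG x) i).le

theorem neg_sq_sub_le_of_abs_sub_le {f g y ε : ℝ} (hf : f ∈ Set.Icc (0 : ℝ) 1)
    (hg : g ∈ Set.Icc (0 : ℝ) 1) (hy : y ∈ Set.Icc (0 : ℝ) 1) (hfg : |f - g| ≤ ε) :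
    -(f - y) ^ 2 ≤ -(g - y) ^ 2 + 2 * ε := by
  obtain ⟨hf0, hf1⟩ := hf
  obtain ⟨hg0, hg1⟩ := hg
  obtain ⟨hy0, hy1⟩ := hy
  have h1 : |f + g - 2 * y| ≤ 2 := abs_le.2 ⟨by linarith, by linarith⟩
  have h2 : |(f - g) * (f + g - 2 * y)| ≤ ε * 2 := by
    rw [abs_mul]
    exact mul_le_mul hfg h1 (abs_nonneg _) ((abs_nonneg _).trans hfg)
  have := (abs_le.1 h2).1
  nlinarith

/-- Union bound over a finite class of measurable functions for the event that some member beats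
the regression function by at least `t` in empirical square loss. -/
theorem measureReal_iUnion_sq_loss_gap_le {X ι : Type*} [MeasurableSpace X] [Fintype ι]
    {ν : Measure (X × ℝ)} [IsProbabilityMeasure ν] {h : X → ℝ} (hh : Measurable h)
    (hh01 : ∀ x, h x ∈ Set.Icc (0 : ℝ) 1) (hy : ∀ᵐ p ∂ν, p.2 ∈ Set.Icc (0 : ℝ) 1)
    (horth : ∀ d : X → ℝ, Measurable d → (∀ x, |d x| ≤ 1) →
      ∫ p, d p.1 * (p.2 - h p.1) ∂ν = 0)
    {f : ι → X → ℝ} (hf : ∀ i, Measurable (f i)) (hf01 : ∀ i x, f i x ∈ Set.Icc (0 : ℝ) 1)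
    (n : ℕ) (t : ℝ) :
    (Measure.pi fun _ : Fin n => ν).real (⋃ i, {ω | t ≤
      ∑ j, ((h (ω j).1 - (ω j).2) ^ 2 - (f i (ω j).1 - (ω j).2) ^ 2)}) ≤
      Fintype.card ι * Real.exp (-(1 / 4) * t) := by
  refine (measureReal_iUnion_fintype_le _).trans ?_
  rw [← nsmul_eq_mul, ← card_univ]
  refine sum_le_card_nsmul _ _ _ fun i _ => ?_
  have hexp := integral_exp_quarter_sq_sub_sq_le_one hh (hf i) hh01 (hf01 i) hy
    (horth (fun x => f i x - h x) ((hf i).sub hh) fun x =>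
      abs_le.2 ⟨by linarith [(hf01 i x).1, (hh01 x).2], by linarith [(hf01 i x).2, (hh01 x).1]⟩)
  exact measureReal_pi_ge_le_exp
    (Z := fun p : X × ℝ => (h p.1 - p.2) ^ 2 - (f i p.1 - p.2) ^ 2) (by norm_num) hexp.1 hexp.2 n t

/-- A measurable event on which some member of a finite class (not assumed measurable) beats the
regression function by at least `t` in empirical square loss has probability at most
`|F| exp (-(t - η) / 4)`. -/
theorem measureReal_le_of_forall_exists_sq_loss_gap {X ι : Type*} [mX : MeasurableSpace X]
    [Fintype ι] {ν : Measure (X × ℝ)} [IsProbabilityMeasure ν] {fstar : X → ℝ}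
    (hfstar : ∀ x, fstar x ∈ Set.Icc (0 : ℝ) 1) (hy : ∀ᵐ p ∂ν, p.2 ∈ Set.Icc (0 : ℝ) 1)
    (hcond : ν[(fun p : X × ℝ => p.2) | MeasurableSpace.comap Prod.fst mX]
      =ᵐ[ν] fun p : X × ℝ => fstar p.1)
    {F : ι → X → ℝ} (hF : ∀ i x, F i x ∈ Set.Icc (0 : ℝ) 1) {n : ℕ}
    {S : Set (Fin n → X × ℝ)} (hS : MeasurableSet S) {t η : ℝ} (hη : 0 < η)
    (hgap : ∀ ω ∈ S, ∃ i, t ≤ ∑ j, (fstar (ω j).1 - (ω j).2) ^ 2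
      - ∑ j, (F i (ω j).1 - (ω j).2) ^ 2) :
    (Measure.pi fun _ : Fin n => ν).real S ≤
      Fintype.card ι * Real.exp (-(1 / 4) * (t - η)) := by
  obtain ⟨h, hhm, hh01, hhae, horth⟩ := exists_measurable_regression_function hfstar hy hcond
  set ε : ℝ := η / (2 * (n + 1)) with hε
  have hε0 : 0 < ε := by positivity
  have hnε : n * (2 * ε) ≤ η := by
    rw [hε]
    have : (0 : ℝ) < n + 1 := by positivity
    field_simp
    linarith
  obtain ⟨G, Φ, hΦ, hGΦ⟩ := exists_label_approx hF hε0
  obtain ⟨G', hG'm, hG'⟩ := exists_measurable_labelling ν G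
  have hae : ∀ᵐ ω ∂Measure.pi fun _ : Fin n => ν, ∀ j,
      (ω j).2 ∈ Set.Icc (0 : ℝ) 1 ∧ fstar (ω j).1 = h (ω j).1 := by
    rw [ae_all_iff]
    intro j
    exact (Measure.quasiMeasurePreserving_eval (fun _ : Fin n => ν) j).ae (hy.and hhae)
  set P : (Fin n → ℕ) → Set (Fin n → X × ℝ) := fun k => ⋃ i, {ω | t - η ≤
    ∑ j, ((h (ω j).1 - (ω j).2) ^ 2 - (Φ (k j) i - (ω j).2) ^ 2)}
  have hPm : ∀ k, MeasurableSet (P k) := fun k =>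
    MeasurableSet.iUnion fun i => measurableSet_le (by fun_prop) (by fun_prop)
  have hSP : ∀ᵐ ω ∂Measure.pi fun _ : Fin n => ν, ω ∈ S → ω ∈ P fun j => G (ω j).1 := by
    filter_upwards [hae] with ω hω hωS
    obtain ⟨i, hi⟩ := hgap ω hωS
    refine Set.mem_iUnion.2 ⟨i, ?_⟩
    rw [← sum_sub_distrib] at hi
    have hsum : ∑ j, ((fstar (ω j).1 - (ω j).2) ^ 2 - (F i (ω j).1 - (ω j).2) ^ 2) ≤
        ∑ j, (((h (ω j).1 - (ω j).2) ^ 2 - (Φ (G (ω j).1) i - (ω j).2) ^ 2) + 2 * ε) := by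
      refine sum_le_sum fun j _ => ?_
      have := neg_sq_sub_le_of_abs_sub_le (hF i (ω j).1) (hΦ (G (ω j).1) i) (hω j).1
        (hGΦ (ω j).1 i)
      rw [(hω j).2]
      linarith
    rw [sum_add_distrib, sum_const, card_univ, Fintype.card_fin, nsmul_eq_mul] at hsum
    simp only [Set.mem_ofPred_eq]
    linarith
  have hsub : S ≤ᵐ[Measure.pi fun _ : Fin n => ν] ⋃ i, {ω | t - η ≤
      ∑ j, ((h (ω j).1 - (ω j).2) ^ 2 - (Φ (G' (ω j).1) i - (ω j).2) ^ 2)} := by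
    filter_upwards [hG' n P S hPm hS hSP] with ω hω hωS
    obtain ⟨i, hi⟩ := Set.mem_iUnion.1 (hω hωS)
    exact Set.mem_iUnion.2 ⟨i, hi⟩
  calc (Measure.pi fun _ : Fin n => ν).real S
      ≤ (Measure.pi fun _ : Fin n => ν).real (⋃ i, {ω | t - η ≤
          ∑ j, ((h (ω j).1 - (ω j).2) ^ 2 - (Φ (G' (ω j).1) i - (ω j).2) ^ 2)}) :=
        ENNReal.toReal_mono (measure_ne_top _ _) (measure_mono_ae hsub)
    _ ≤ Fintype.card ι * Real.exp (-(1 / 4) * (t - η)) :=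
        measureReal_iUnion_sq_loss_gap_le hhm hh01 hy horth
          (fun i => (measurable_from_nat (f := fun k => Φ k i)).comp hG'm) (fun i x => hΦ _ i) n _

end SquareLossRegression

/-- least squares regression: the regression function nearly minimizes
the empirical square loss.
There is an absolute constant `c > 0` such that: the single-sample law `ν` on `X × ℝ`
draws `x ∼ μm` (the first marginal of `ν` is `μm`), has `y ∈ [0,1]` a.s., and has
conditional mean `E[y|x] = fstar x` (expressed via the conditional expectation with
respect to the σ-algebra generated by the first projection); the dataset of `n` pairs is
i.i.d. (product measure).  For any finite class `F` of `[0,1]`-valued functions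
containing `fstar`, with probability at least `1 − δ`:
`∑ⱼ (fstar xⱼ − yⱼ)² − min_{f ∈ F} ∑ⱼ (f xⱼ − yⱼ)² ≤ c log(|F|/δ)`. -/
theorem regression_fstar_nearly_minimizes_empirical_loss :
    ∃ c : ℝ, 0 < c ∧
      ∀ (X : Type) [mX : MeasurableSpace X]
        (μm : Measure X) [IsProbabilityMeasure μm]
        (fstar : X → ℝ), (∀ x, fstar x ∈ Set.Icc (0 : ℝ) 1) →
      ∀ (ν : Measure (X × ℝ)) [IsProbabilityMeasure ν],
        ν.map Prod.fst = μm →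
        (∀ᵐ p ∂ν, p.2 ∈ Set.Icc (0 : ℝ) 1) →
        (ν[(fun p : X × ℝ => p.2) | MeasurableSpace.comap Prod.fst mX]
          =ᵐ[ν] fun p : X × ℝ => fstar p.1) →
      ∀ (n : ℕ) (ι : Type) [Fintype ι] [Nonempty ι]
        (F : ι → X → ℝ),
        (∀ i x, F i x ∈ Set.Icc (0 : ℝ) 1) → (∃ i, F i = fstar) →
      ∀ (δ : ℝ), δ ∈ Set.Ioc (0 : ℝ) 1 →
      ENNReal.ofReal (1 - δ) ≤
        (Measure.pi fun _ : Fin n => ν)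
          {data | ∑ j : Fin n, (fstar (data j).1 - (data j).2) ^ 2
              - univ.inf' univ_nonempty
                  (fun i => ∑ j : Fin n, (F i (data j).1 - (data j).2) ^ 2)
              ≤ c * Real.log ((Fintype.card ι : ℝ) / δ)} := by
  refine ⟨8, by norm_num, ?_⟩
  intro X mX μm _ fstar hfstar ν _ _ hy hcond n ι _ _ F hF _ δ ⟨hδ0, hδ1⟩
  rcases hδ1.eq_or_lt with rfl | hδ1
  · simp
  set M : ℝ := (Fintype.card ι : ℝ) with hM
  have hM1 : 1 ≤ M := Nat.one_le_cast.2 Fintype.card_pos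
  have hlog : 0 < Real.log (M / δ) := Real.log_pos ((one_lt_div hδ0).2 (by linarith))
  set good := {data : Fin n → X × ℝ | ∑ j : Fin n, (fstar (data j).1 - (data j).2) ^ 2
    - univ.inf' univ_nonempty (fun i => ∑ j : Fin n, (F i (data j).1 - (data j).2) ^ 2)
    ≤ 8 * Real.log (M / δ)} with hgood
  set P := Measure.pi fun _ : Fin n => ν
  have hT := measurableSet_toMeasurable P good
  have hbad : P.real (toMeasurable P good)ᶜ ≤ δ := by
    refine (SquareLossRegression.measureReal_le_of_forall_exists_sq_loss_gap hfstar hy hcond hF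
      hT.compl (t := 8 * Real.log (M / δ)) (η := 4 * Real.log (M / δ)) (by positivity)
      fun ω hω => ?_).trans_eq ?_
    · have hω' : ω ∉ good := fun h => hω (subset_toMeasurable _ _ h)
      simp only [hgood, Set.mem_ofPred_eq, not_le] at hω'
      obtain ⟨i, -, hi⟩ := exists_mem_eq_inf' (univ_nonempty (α := ι))
        (fun i => ∑ j : Fin n, (F i (ω j).1 - (ω j).2) ^ 2)
      exact ⟨i, by rw [← hi]; exact hω'.le⟩
    · rw [show -(1 / 4) * (8 * Real.log (M / δ) - 4 * Real.log (M / δ)) = -Real.log (M / δ) by ring,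
        Real.exp_neg, Real.exp_log (by positivity), ← hM]
      field_simp
  rw [← measure_toMeasurable good]
  refine ENNReal.ofReal_le_of_le_toReal ?_
  have := probReal_compl_eq_one_sub (μ := P) hT
  change 1 - δ ≤ P.real _
  linarith
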